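/- arXiv:2309.14738 — 3 statements merged into one kernel-verified Lean document; each statement's English description precedes it below -/
import Mathlib

section
/- For all real a, b ≥ 0 and all α ∈ [0, π/2], the infimum over x ∈ [0,1] of a·(1 − cos(α − arcsin x)) + b·x is at least π^{−1} · min(aα², bα). -/
theorem aux_pos (u : ℝ) (h0 : 0 ≤ u) (h1 : u ≤ Real.pi / 2) :
    Real.pi⁻¹ * u ^ 2 ≤ 1 - Real.cos u := by
  have hpi := Real.pi_gt_d2
  have hpi2 := Real.pi_lt_d2
  have hinv : Real.pi⁻¹ ≤ 0.32 := by
    rw [inv_le_comm₀ Real.pi_pos (by norm_num)]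
    norm_num at *
    linarith
  rcases h0.eq_or_lt with h | h
  · subst h; simp
  obtain ⟨v, rfl⟩ : ∃ v, u = 2 * v := ⟨u / 2, by ring⟩
  have hv : 0 < v := by linarith
  have hv1 : v ≤ 0.79 := by norm_num at *; linarith
  have hs := Real.sin_gt_sub_cube hv
  have hs2 : 0.84 * v ≤ Real.sin v := by
    have : v ^ 2 ≤ 0.64 := by norm_num at *; nlinarith
    have : v ^ 3 ≤ 0.64 * v := by
      have := mul_le_mul_of_nonneg_right this hv.le
      nlinarith
    norm_num at *
    linarith
  have hc : Real.cos (2 * v) = 1 - 2 * Real.sin v ^ 2 := by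
    rw [Real.cos_two_mul, Real.cos_sq']; ring
  have hsq : (0.84 * v) ^ 2 ≤ Real.sin v ^ 2 := by gcongr
  have h3 : Real.pi⁻¹ * (2 * v) ^ 2 ≤ 0.32 * (2 * v) ^ 2 := by gcongr
  rw [hc]
  norm_num at *
  nlinarith [sq_nonneg v]

theorem stmt_11 :
    ∀ a b : ℝ, 0 ≤ a → 0 ≤ b → ∀ α : ℝ, α ∈ Set.Icc (0:ℝ) (Real.pi / 2) →
      ∀ x : ℝ, x ∈ Set.Icc (0:ℝ) 1 →
        Real.pi⁻¹ * min (a * α ^ 2) (b * α) ≤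
          a * (1 - Real.cos (α - Real.arcsin x)) + b * x := by
  intro a b ha hb α hα x hx
  obtain ⟨hα0, hα1⟩ := hα
  obtain ⟨hx0, hx1⟩ := hx
  have ht0 : 0 ≤ Real.arcsin x := Real.arcsin_nonneg.2 hx0
  have ht1 := Real.arcsin_le_pi_div_two x
  have hsin : Real.sin (Real.arcsin x) = x := Real.sin_arcsin (by linarith) hx1
  have hj := Real.mul_le_sin ht0 ht1
  rw [hsin] at hj
  set t := Real.arcsin x
  have hcos : Real.pi⁻¹ * (α - t) ^ 2 ≤ 1 - Real.cos (α - t) := by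
    have := aux_pos |α - t| (abs_nonneg _) (abs_le.2 ⟨by linarith, by linarith⟩)
    rwa [sq_abs, Real.cos_abs] at this
  have hp : 0 < Real.pi⁻¹ := inv_pos.2 Real.pi_pos
  have h1 := mul_le_mul_of_nonneg_left hcos ha
  have h2 := mul_le_mul_of_nonneg_left hj hb
  have key : min (a * α ^ 2) (b * α) ≤ a * (α - t) ^ 2 + 2 * b * t := by
    rcases hα0.eq_or_lt with h | h
    · rw [← h]; simp; positivity
    have m1 := min_le_left (a * α ^ 2) (b * α)
    have m2 := min_le_right (a * α ^ 2) (b * α)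
    have m0 : 0 ≤ min (a * α ^ 2) (b * α) := le_min (by positivity) (by positivity)
    set m := min (a * α ^ 2) (b * α)
    have e1 := mul_le_mul_of_nonneg_right m1 (sq_nonneg (α - t))
    have e2 := mul_le_mul_of_nonneg_right m2 (mul_nonneg ht0 hα0)
    have e3 := mul_nonneg m0 (sq_nonneg t)
    have : m * α ^ 2 ≤ (a * (α - t) ^ 2 + 2 * b * t) * α ^ 2 := by nlinarith
    exact le_of_mul_le_mul_right this (by positivity)
  have h3 := mul_le_mul_of_nonneg_left key hp.le
  rw [div_eq_mul_inv] at h2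
  linarith
end

section
/- Let r : ℕ → ℝ satisfy r(s) = (Ψ(λ)/λ)s + o(s) as s → ∞. For α ∈ [0, π/2] set θ₁ = (cos α, sin α), θ₂ = (cos α, −sin α), and for r > 0 set B_r = { (x, y₁, y₂) ∈ (ℝ²)³ : |x| ≤ r, |x+y₁| ≤ r, |x+y₂| ≤ r }. For s ∈ ℕ define h_α(x, y₁, y₂) = λ⟨x+y₁, θ₁⟩ + λ⟨x+y₂, θ₂⟩ − I(x/s)·s − (λ+ε)·max(|y₁|, |y₂|). For (x, y₁, y₂) ∈ B_r write 𝔪 = max(|x+y₁|, |x+y₂|), 𝔡 = |y₁ − y₂|/2, and let γ ∈ (−π, π] be the angle between the vector (1,0) and x+y₁. Then for all sufficiently large s (with r = r(s)): (i) h_max := sup_{α ∈ [0,π/2]} sup_{(x,y₁,y₂) ∈ B_r} h_α(x, y₁, y₂) = h₀( r·(1,0), (0,0), (0,0) ); (ii) if α ≤ π/6, then for every (x, y₁, y₂) ∈ B_r with γ ∈ [0, π/4]: h_max − h_α(x, y₁, y₂) ≥ (λ − ε/10)(r − 𝔪) + 2λ𝔪[1 − cos(α − arcsin(𝔡/𝔪))]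 + 0.99·ε·𝔡; (iii) there exists c > 0 such that for every α ∈ [0, π/2] and every (x, y₁, y₂) ∈ B_r: h_max − h_α(x, y₁, y₂) ≥ (λ − ε/10)(r − 𝔪) + c·α². -/
open MeasureTheory ProbabilityTheory

lemma aux_tangent {Ω : Type*} [MeasurableSpace Ω] (μ : Measure Ω) [IsProbabilityMeasure μ]
    (X : Ω → ℝ) (a b : ℝ) (ha : Integrable (fun ω => Real.exp (a * X ω)) μ)
    (hb : Integrable (fun ω => Real.exp (b * X ω)) μ)
    (hXb : Integrable (fun ω => X ω * Real.exp (b * X ω)) μ) :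
    Real.log (∫ ω, Real.exp (b * X ω) ∂μ) + (a - b) * ((∫ ω, X ω * Real.exp (b * X ω) ∂μ) /
      ∫ ω, Real.exp (b * X ω) ∂μ) ≤ Real.log (∫ ω, Real.exp (a * X ω) ∂μ) ∧
    (Real.log (∫ ω, Real.exp (a * X ω) ∂μ) = Real.log (∫ ω, Real.exp (b * X ω) ∂μ) +
      (a - b) * ((∫ ω, X ω * Real.exp (b * X ω) ∂μ) / ∫ ω, Real.exp (b * X ω) ∂μ) → a ≠ b →
      ∃ c : ℝ, ∀ᵐ ω ∂μ, X ω = c) := by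
  have hMb : 0 < ∫ ω, Real.exp (b * X ω) ∂μ := integral_exp_pos hb
  have hMa : 0 < ∫ ω, Real.exp (a * X ω) ∂μ := integral_exp_pos ha
  set Mb := ∫ ω, Real.exp (b * X ω) ∂μ with hMbd
  set Ma := ∫ ω, Real.exp (a * X ω) ∂μ with hMad
  set A := ∫ ω, X ω * Real.exp (b * X ω) ∂μ with hA
  set w := A / Mb with hw
  let f : Ω → ℝ := fun ω => Real.exp (-((a - b) * w)) * Real.exp (a * X ω)
    - ((1 - (a - b) * w) * Real.exp (b * X ω) + (a - b) * (X ω * Real.exp (b * X ω)))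
  have hf_eq : ∀ ω, f ω = Real.exp (b * X ω) *
      (Real.exp ((a - b) * (X ω - w)) - ((a - b) * (X ω - w) + 1)) := by
    intro ω
    have : Real.exp (-((a - b) * w)) * Real.exp (a * X ω)
        = Real.exp (b * X ω) * Real.exp ((a - b) * (X ω - w)) := by
      rw [← Real.exp_add, ← Real.exp_add]; congr 1; ring
    simp only [f, this]; ring
  have hf0 : ∀ ω, 0 ≤ f ω := by
    intro ω
    rw [hf_eq]
    exact mul_nonneg (Real.exp_pos _).le (by linarith [Real.add_one_le_exp ((a - b) * (X ω - w))])
  have hi2 : Integrable (fun ω => (1 - (a - b) * w) * Real.exp (b * X ω) +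
      (a - b) * (X ω * Real.exp (b * X ω))) μ := (hb.const_mul _).add (hXb.const_mul _)
  have hfi : Integrable f μ := (ha.const_mul _).sub hi2
  have hint : ∫ ω, f ω ∂μ = Real.exp (-((a - b) * w)) * Ma - Mb := by
    simp only [f]
    rw [integral_sub (ha.const_mul _) hi2, integral_add (hb.const_mul _) (hXb.const_mul _),
      integral_const_mul, integral_const_mul, integral_const_mul, ← hMbd, ← hMad, ← hA]
    have : w * Mb = A := by rw [hw]; field_simp
    linear_combination (a - b) * this
  have key : Real.log (Real.exp (-((a - b) * w)) * Ma) = Real.log Ma - (a - b) * w := by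
    rw [Real.log_mul (Real.exp_pos _).ne' hMa.ne', Real.log_exp]; ring
  constructor
  · have h0 : 0 ≤ ∫ ω, f ω ∂μ := integral_nonneg hf0
    have h1 : Mb ≤ Real.exp (-((a - b) * w)) * Ma := by linarith
    have := Real.log_le_log hMb h1
    linarith
  · intro heq hne
    have h1 : Real.log (Real.exp (-((a - b) * w)) * Ma) = Real.log Mb := by rw [key]; linarith
    have h2 := Real.log_injOn_pos (Set.mem_Ioi.2 (by positivity)) (Set.mem_Ioi.2 hMb) h1
    have h3 : ∫ ω, f ω ∂μ = 0 := by rw [hint, h2]; ring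
    rw [integral_eq_zero_iff_of_nonneg hf0 hfi] at h3
    refine ⟨w, ?_⟩
    filter_upwards [h3] with ω hω
    by_contra hc
    have hne' : (a - b) * (X ω - w) ≠ 0 := mul_ne_zero (sub_ne_zero.2 hne) (sub_ne_zero.2 hc)
    have := Real.add_one_lt_exp hne'
    have h4 : f ω = 0 := hω
    rw [hf_eq] at h4
    have := mul_pos (Real.exp_pos (b * X ω)) (sub_pos.2 this)
    linarith

/-- parallelogram-type estimate -/
lemma aux_geo (a b c d M D α : ℝ) (hM : 0 ≤ M) (hD : 0 ≤ D) (hc : 0 ≤ Real.cos α)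
    (hs : 0 ≤ Real.sin α)
    (h1 : a ^ 2 + b ^ 2 ≤ M ^ 2) (h2 : c ^ 2 + d ^ 2 ≤ M ^ 2)
    (h3 : (a - c) ^ 2 + (b - d) ^ 2 = 4 * D ^ 2) :
    D ≤ M ∧ (a * Real.cos α + b * Real.sin α) + (c * Real.cos α - d * Real.sin α) ≤
      2 * M * Real.cos (α - Real.arcsin (D / M)) := by
  have hDM : D ≤ M := by
    refine (pow_le_pow_iff_left₀ hD hM two_ne_zero).1 ?_
    nlinarith [sq_nonneg (a + c), sq_nonneg (b + d)]
  refine ⟨hDM, ?_⟩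
  rw [Real.cos_sub]
  have hq : M * Real.sin (Real.arcsin (D / M)) = D ∧
      M * Real.cos (Real.arcsin (D / M)) = Real.sqrt (M ^ 2 - D ^ 2) := by
    rcases hM.eq_or_lt with h0 | h0
    · have : D = 0 := by linarith
      subst this; subst h0; simp
    · have hle : D / M ≤ 1 := (div_le_one h0).2 hDM
      have hge : -1 ≤ D / M := by have : 0 ≤ D / M := by positivity
                                  linarith
      constructor
      · rw [Real.sin_arcsin hge hle]; field_simp
      · rw [Real.cos_arcsin]
        rw [show M ^ 2 - D ^ 2 = M ^ 2 * (1 - (D / M) ^ 2) by field_simp,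
          Real.sqrt_mul (by positivity), Real.sqrt_sq h0.le]
  have e1 : a + c ≤ 2 * Real.sqrt (M ^ 2 - D ^ 2) := by
    have : (a + c) / 2 ≤ Real.sqrt (M ^ 2 - D ^ 2) := by
      apply Real.le_sqrt_of_sq_le
      nlinarith [sq_nonneg (b + d)]
    linarith
  have e2 : b - d ≤ 2 * D := by
    refine abs_le_of_sq_le_sq' ?_ (by positivity) |>.2
    nlinarith [sq_nonneg (a - c)]
  have := mul_le_mul_of_nonneg_right e1 hc
  have := mul_le_mul_of_nonneg_right e2 hs
  calc _ = (a + c) * Real.cos α + (b - d) * Real.sin α := by ring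
    _ ≤ 2 * (M * Real.cos (Real.arcsin (D / M))) * Real.cos α
        + 2 * (M * Real.sin (Real.arcsin (D / M))) * Real.sin α := by
      rw [hq.1, hq.2]; linarith
    _ = _ := by ring

/-- quadratic lower bound in the angle -/
lemma aux_quad (lam ε R M D α : ℝ) (hl : 0 < lam) (hε : 0 < ε) (hR : 1 ≤ R) (hD : 0 ≤ D)
    (hDM : D ≤ M) (hMR : M ≤ R) (hα : 0 ≤ α) (hα2 : α ≤ Real.pi / 2) :
    min (lam / 40) (ε / 200) * α ^ 2 ≤ (ε / 20) * (R - M)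
      + 2 * lam * M * (1 - Real.cos (α - Real.arcsin (D / M))) + 0.99 * ε * D := by
  have hpi := Real.pi_lt_four
  have hpi3 := Real.pi_gt_three
  have hM : 0 ≤ M := hD.trans hDM
  have hmin1 := min_le_left (lam / 40) (ε / 200)
  have hmin2 := min_le_right (lam / 40) (ε / 200)
  set c := min (lam / 40) (ε / 200)
  have hα3 : α ^ 2 ≤ 4 := by nlinarith
  have hα4 : α ^ 2 ≤ 2 * α := by nlinarith
  have hcos : 0 ≤ 1 - Real.cos (α - Real.arcsin (D / M)) := by
    linarith [Real.cos_le_one (α - Real.arcsin (D / M))]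
  have t1 : 0 ≤ (ε / 20) * (R - M) := mul_nonneg (by positivity) (by linarith)
  have t2 : 0 ≤ 2 * lam * M * (1 - Real.cos (α - Real.arcsin (D / M))) := by positivity
  have t3 : 0 ≤ 0.99 * ε * D := by positivity
  have u2 : c * α ^ 2 ≤ ε / 200 * α ^ 2 := by gcongr
  have u1 : c * α ^ 2 ≤ lam / 40 * α ^ 2 := by gcongr
  rcases le_or_gt M (1 / 2) with hm | hm
  · have : ε / 200 * α ^ 2 ≤ ε / 200 * 4 := by gcongr
    have : ε / 20 * (1 / 2) ≤ (ε / 20) * (R - M) := by gcongr; linarith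
    linarith
  · have hM0 : 0 < M := by linarith
    have hb0 : 0 ≤ Real.arcsin (D / M) := Real.arcsin_nonneg.2 (by positivity)
    have hb1 := Real.arcsin_le_pi_div_two (D / M)
    have hsin : Real.sin (Real.arcsin (D / M)) = D / M :=
      Real.sin_arcsin (by linarith [show 0 ≤ D / M by positivity]) ((div_le_one hM0).2 hDM)
    set β := Real.arcsin (D / M)
    rcases le_or_gt (α / 2) β with hβ | hβ
    · have h1 : 2 / Real.pi * β ≤ Real.sin β := Real.mul_le_sin hb0 hb1
      have h2 : 1 / 2 * β ≤ 2 / Real.pi * β := by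
        apply mul_le_mul_of_nonneg_right _ hb0
        rw [div_le_div_iff₀ (by norm_num) (by linarith)]; linarith
      have h3 : D = M * Real.sin β := by rw [hsin]; field_simp
      have h4 : 1 / 2 * (α / 4) ≤ D := by
        rw [h3]; apply mul_le_mul hm.le (by linarith) (by positivity) hM0.le
      have : ε / 200 * α ^ 2 ≤ ε / 200 * (2 * α) := by gcongr
      have : 0.99 * ε * (1 / 2 * (α / 4)) ≤ 0.99 * ε * D := by gcongr
      nlinarith
    · have habs : |α - β| ≤ Real.pi := by rw [abs_le]; constructor <;> linarith
      have h1 := Real.cos_le_one_sub_mul_cos_sq habs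
      have h2 : (α / 2) ^ 2 ≤ (α - β) ^ 2 := by gcongr; linarith
      have h3 : (1:ℝ) / 10 ≤ 2 / Real.pi ^ 2 := by
        rw [div_le_div_iff₀ (by norm_num) (by positivity)]
        nlinarith [Real.pi_lt_d2]
      have h4 : 1 / 10 * (α / 2) ^ 2 ≤ 1 - Real.cos (α - β) := by
        have : 1 / 10 * (α / 2) ^ 2 ≤ 2 / Real.pi ^ 2 * (α - β) ^ 2 := by gcongr
        linarith
      have : 2 * lam * (1 / 2) * (1 / 10 * (α / 2) ^ 2) ≤
        2 * lam * M * (1 - Real.cos (α - β)) := by gcongr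
      nlinarith

lemma aux_rate {Ω : Type*} [MeasurableSpace Ω] (μ : Measure Ω) [IsProbabilityMeasure μ]
    (X : Ω → ℝ)
    (hsym : ∀ a : ℝ, Integrable (fun ω => Real.exp (a * X ω)) μ →
      Integrable (fun ω => Real.exp (-a * X ω)) μ ∧
      ∫ ω, Real.exp (-a * X ω) ∂μ = ∫ ω, Real.exp (a * X ω) ∂μ)
    (m : ℝ) (hm : 1 < m)
    (hXnondeg : ¬ ∃ c : ℝ, ∀ᵐ ω ∂μ, X ω = c)
    (Ψ : ℝ → ℝ)
    (hΨdef : ∀ u : ℝ, Integrable (fun ω => Real.exp (u * X ω)) μ →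
      Ψ u = Real.log (m * ∫ ω, Real.exp (u * X ω) ∂μ))
    (lam ε δ : ℝ) (hlam : 0 < lam) (hδ : 0 < δ) (hδε : δ < ε)
    (hexp : Integrable (fun ω => Real.exp ((lam + ε) * X ω)) μ)
    (hcrit : lam * ((m * ∫ ω, X ω * Real.exp (lam * X ω) ∂μ) /
        (m * ∫ ω, Real.exp (lam * X ω) ∂μ)) - Ψ lam = 0)
    (I₁ : ℝ → ℝ)
    (hI₁ : ∀ b : ℝ, I₁ b = sSup {v : ℝ | ∃ a : ℝ,
      Integrable (fun ω => Real.exp (a * X ω)) μ ∧ v = a * b - Ψ a + Real.log m}) :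
    0 < Ψ lam / lam ∧ ∃ w, Ψ lam / lam < w ∧ ∀ b b' : ℝ, 0 ≤ b → b ≤ b' → b' ≤ w →
      I₁ b' - I₁ b ≤ (lam + δ) * (b' - b) := by
  have hm0 : 0 < m := by linarith
  have hIoo : Set.Ioo (-(lam + ε)) (lam + ε) ⊆ interior (integrableExpSet X μ) := by
    apply interior_maximal _ isOpen_Ioo
    intro t ht
    have h1 : (lam + ε) ∈ integrableExpSet X μ := hexp
    have h2 : -(lam + ε) ∈ integrableExpSet X μ := (hsym _ hexp).1
    exact convex_integrableExpSet.ordConnected.out h2 h1 ⟨ht.1.le, ht.2.le⟩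
  have hL : lam ∈ interior (integrableExpSet X μ) := hIoo ⟨by linarith, by linarith⟩
  have hA : lam + δ ∈ interior (integrableExpSet X μ) := hIoo ⟨by linarith, by linarith⟩
  have hLi : Integrable (fun ω => Real.exp (lam * X ω)) μ :=
    integrable_of_mem_integrableExpSet (interior_subset hL)
  have hAi : Integrable (fun ω => Real.exp ((lam + δ) * X ω)) μ :=
    integrable_of_mem_integrableExpSet (interior_subset hA)
  have hLX : Integrable (fun ω => X ω * Real.exp (lam * X ω)) μ := by
    simpa using integrable_pow_mul_exp_of_mem_interior_integrableExpSet hL 1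
  have hAX : Integrable (fun ω => X ω * Real.exp ((lam + δ) * X ω)) μ := by
    simpa using integrable_pow_mul_exp_of_mem_interior_integrableExpSet hA 1
  have hΨ : ∀ u : ℝ, Integrable (fun ω => Real.exp (u * X ω)) μ →
      Ψ u = Real.log m + Real.log (∫ ω, Real.exp (u * X ω) ∂μ) := by
    intro u hu
    rw [hΨdef u hu, Real.log_mul hm0.ne' (integral_exp_pos hu).ne']
  have hlogm : 0 < Real.log m := Real.log_pos hm
  have hML : 1 ≤ ∫ ω, Real.exp (lam * X ω) ∂μ := by
    obtain ⟨h1, h2⟩ := hsym lam hLi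
    have h3 : (2:ℝ) ≤ ∫ ω, (Real.exp (lam * X ω) + Real.exp (-lam * X ω)) ∂μ := by
      calc (2:ℝ) = ∫ ω, (2:ℝ) ∂μ := by simp
        _ ≤ _ := by
          apply integral_mono (integrable_const _) (hLi.add h1)
          intro ω
          have e1 := Real.add_one_le_exp (lam * X ω)
          have e2 := Real.add_one_le_exp (-lam * X ω)
          simp only [Pi.add_apply]
          linarith
    rw [integral_add hLi h1, h2] at h3
    linarith
  have hΨL : 0 < Ψ lam := by
    rw [hΨ lam hLi]; linarith [Real.log_nonneg hML]
  have hv : Ψ lam / lam = (∫ ω, X ω * Real.exp (lam * X ω) ∂μ) /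
      ∫ ω, Real.exp (lam * X ω) ∂μ := by
    rw [mul_div_mul_left _ _ hm0.ne'] at hcrit
    rw [div_eq_iff hlam.ne']; linarith
  have tL := aux_tangent μ X (lam + δ) lam hAi hLi hLX
  have tA := fun a ha => (aux_tangent μ X a (lam + δ) ha hAi hAX).1
  rw [← hv] at tL
  set w := (∫ ω, X ω * Real.exp ((lam + δ) * X ω) ∂μ) /
      ∫ ω, Real.exp ((lam + δ) * X ω) ∂μ with hw
  have tL' := lt_of_le_of_ne tL.1 (fun h => hXnondeg (tL.2 h.symm (by linarith)))
  refine ⟨div_pos hΨL hlam, w, ?_, ?_⟩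
  · have := tA lam hLi
    have h5 : δ * (Ψ lam / lam) < δ * w := by linarith
    exact lt_of_mul_lt_mul_left h5 hδ.le
  have hT : ∀ a, Integrable (fun ω => Real.exp (a * X ω)) μ →
      Ψ (lam + δ) + (a - (lam + δ)) * w ≤ Ψ a := by
    intro a ha
    rw [hΨ _ ha, hΨ _ hAi]; linarith [tA a ha]
  have hbdd : ∀ b, 0 ≤ b → b ≤ w → BddAbove {v : ℝ | ∃ a : ℝ,
      Integrable (fun ω => Real.exp (a * X ω)) μ ∧ v = a * b - Ψ a + Real.log m} := by
    intro b hb hbw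
    have hpos : ∀ a, 0 ≤ a → Integrable (fun ω => Real.exp (a * X ω)) μ →
        a * b - Ψ a + Real.log m ≤ (lam + δ) * w - Ψ (lam + δ) + Real.log m := by
      intro a ha hi
      have := hT a hi
      have := mul_le_mul_of_nonneg_left hbw ha
      linarith
    refine ⟨(lam + δ) * w - Ψ (lam + δ) + Real.log m, ?_⟩
    rintro v ⟨a, ha, rfl⟩
    rcases le_total 0 a with h0 | h0
    · exact hpos a h0 ha
    · obtain ⟨h1, h2⟩ := hsym a ha
      have h3 := hpos (-a) (by linarith) h1
      have h4 : Ψ (-a) = Ψ a := by rw [hΨ _ h1, hΨ _ ha, h2]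
      rw [h4] at h3
      nlinarith
  intro b b' hb hbb hbw
  have hle : ∀ a, Integrable (fun ω => Real.exp (a * X ω)) μ →
      a * b - Ψ a + Real.log m ≤ I₁ b := by
    intro a ha
    rw [hI₁ b]
    exact le_csSup (hbdd b hb (hbb.trans hbw)) ⟨a, ha, rfl⟩
  have : I₁ b' ≤ I₁ b + (lam + δ) * (b' - b) := by
    rw [hI₁ b']
    refine csSup_le ⟨lam * b' - Ψ lam + Real.log m, lam, hLi, rfl⟩ ?_
    rintro v ⟨a, ha, rfl⟩
    rcases le_total a (lam + δ) with h0 | h0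
    · have := hle a ha
      have := mul_le_mul_of_nonneg_right h0 (sub_nonneg.2 hbb)
      linarith
    · have := hle _ hAi
      have := hT a ha
      have := mul_le_mul_of_nonneg_left hbw (sub_nonneg.2 h0)
      linarith
  linarith

/-- Geometric properties of the function `h_α` built from the rate function of a
rotation-invariant random vector in the plane (Lemma "in Gang kommen" of the paper).
Here `p = (x, y₁, y₂)`, `𝔪 = max(|x+y₁|,|x+y₂|)`, `𝔡 = |y₁−y₂|/2`, and `arg (x+y₁)`
is the angle `γ ∈ (−π, π]` between `(1,0)` and `x + y₁`. -/
theorem stmt_18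
    {Ω : Type*} [MeasurableSpace Ω] (μ : Measure Ω) [IsProbabilityMeasure μ]
    (Q : Ω → ℝ × ℝ) (hQmeas : Measurable Q)
    (hrot : ∀ φ : ℝ,
      Measure.map (fun ω => (Real.cos φ * (Q ω).1 - Real.sin φ * (Q ω).2,
        Real.sin φ * (Q ω).1 + Real.cos φ * (Q ω).2)) μ = Measure.map Q μ)
    (m : ℝ) (hm : 1 < m)
    (X : Ω → ℝ) (hX : ∀ ω, X ω = (Q ω).1)
    (hXnondeg : ¬ ∃ c : ℝ, ∀ᵐ ω ∂μ, X ω = c)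
    (Ψ : ℝ → ℝ)
    (hΨdef : ∀ u : ℝ, Integrable (fun ω => Real.exp (u * X ω)) μ →
      Ψ u = Real.log (m * ∫ ω, Real.exp (u * X ω) ∂μ))
    (lam ε : ℝ) (hlam : 0 < lam) (hε : 0 < ε)
    (hexp : Integrable (fun ω => Real.exp ((lam + ε) * X ω)) μ)
    (hcrit : lam * ((m * ∫ ω, X ω * Real.exp (lam * X ω) ∂μ) /
        (m * ∫ ω, Real.exp (lam * X ω) ∂μ)) - Ψ lam = 0)
    (I₁ : ℝ → ℝ)
    (hI₁ : ∀ b : ℝ, I₁ b = sSup {v : ℝ | ∃ a : ℝ,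
      Integrable (fun ω => Real.exp (a * X ω)) μ ∧ v = a * b - Ψ a + Real.log m})
    (nrm : ℝ × ℝ → ℝ) (hnrm : ∀ p : ℝ × ℝ, nrm p = Real.sqrt (p.1 ^ 2 + p.2 ^ 2))
    (arg : ℝ × ℝ → ℝ) (harg : ∀ p : ℝ × ℝ, arg p = Complex.arg ⟨p.1, p.2⟩)
    (r : ℕ → ℝ)
    (hr : Filter.Tendsto (fun s : ℕ => (r s - Ψ lam / lam * (s : ℝ)) / (s : ℝ))
      Filter.atTop (nhds 0))
    (B : ℝ → Set ((ℝ × ℝ) × (ℝ × ℝ) × (ℝ × ℝ)))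
    (hB : ∀ ρ : ℝ, B ρ =
      {p | nrm p.1 ≤ ρ ∧ nrm (p.1 + p.2.1) ≤ ρ ∧ nrm (p.1 + p.2.2) ≤ ρ})
    (h : ℕ → ℝ → (ℝ × ℝ) × (ℝ × ℝ) × (ℝ × ℝ) → ℝ)
    (hhdef : ∀ (s : ℕ) (α : ℝ) (p : (ℝ × ℝ) × (ℝ × ℝ) × (ℝ × ℝ)), h s α p =
      lam * ((p.1.1 + p.2.1.1) * Real.cos α + (p.1.2 + p.2.1.2) * Real.sin α)
      + lam * ((p.1.1 + p.2.2.1) * Real.cos α - (p.1.2 + p.2.2.2) * Real.sin α)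
      - I₁ (nrm p.1 / (s : ℝ)) * (s : ℝ)
      - (lam + ε) * max (nrm p.2.1) (nrm p.2.2))
    (hmax : ℕ → ℝ)
    (hhmax : ∀ s : ℕ, hmax s = sSup {v : ℝ |
      ∃ α ∈ Set.Icc (0:ℝ) (Real.pi / 2), ∃ p ∈ B (r s), v = h s α p}) :
    ∃ c : ℝ, 0 < c ∧ ∃ s₀ : ℕ, ∀ s : ℕ, s₀ ≤ s →
      (hmax s = h s 0 ((r s, 0), (0, 0), (0, 0))) ∧
      (∀ α ∈ Set.Icc (0:ℝ) (Real.pi / 6), ∀ p ∈ B (r s),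
        arg (p.1 + p.2.1) ∈ Set.Icc (0:ℝ) (Real.pi / 4) →
        (lam - ε / 10) * (r s - max (nrm (p.1 + p.2.1)) (nrm (p.1 + p.2.2)))
          + 2 * lam * max (nrm (p.1 + p.2.1)) (nrm (p.1 + p.2.2)) *
            (1 - Real.cos (α - Real.arcsin ((nrm (p.2.1 - p.2.2) / 2) /
              max (nrm (p.1 + p.2.1)) (nrm (p.1 + p.2.2)))))
          + 0.99 * ε * (nrm (p.2.1 - p.2.2) / 2)
          ≤ hmax s - h s α p) ∧
      (∀ α ∈ Set.Icc (0:ℝ) (Real.pi / 2), ∀ p ∈ B (r s),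
        (lam - ε / 10) * (r s - max (nrm (p.1 + p.2.1)) (nrm (p.1 + p.2.2)))
          + c * α ^ 2
          ≤ hmax s - h s α p) := by
  have hXm : Measurable X := by
    have : X = fun ω => (Q ω).1 := funext hX
    rw [this]; exact hQmeas.fst
  have hmap : Measure.map (fun ω => -X ω) μ = Measure.map X μ := by
    have h1 := congrArg (Measure.map (Prod.fst : ℝ × ℝ → ℝ)) (hrot Real.pi)
    rw [Measure.map_map measurable_fst (by fun_prop), Measure.map_map measurable_fst hQmeas] at h1
    have e1 : (Prod.fst ∘ fun ω => (Real.cos Real.pi * (Q ω).1 - Real.sin Real.pi * (Q ω).2,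
        Real.sin Real.pi * (Q ω).1 + Real.cos Real.pi * (Q ω).2)) = fun ω => -X ω := by
      funext ω; simp [hX]
    have e2 : (Prod.fst ∘ Q) = X := by funext ω; simp [hX]
    rw [e1, e2] at h1
    exact h1
  have hid : IdentDistrib (fun ω => -X ω) X μ μ :=
    ⟨hXm.neg.aemeasurable, hXm.aemeasurable, hmap⟩
  have hsym : ∀ a : ℝ, Integrable (fun ω => Real.exp (a * X ω)) μ →
      Integrable (fun ω => Real.exp (-a * X ω)) μ ∧
      ∫ ω, Real.exp (-a * X ω) ∂μ = ∫ ω, Real.exp (a * X ω) ∂μ := by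
    intro a ha
    have h2 := hid.comp (u := fun x => Real.exp (a * x)) (by fun_prop)
    have e : ((fun x => Real.exp (a * x)) ∘ fun ω => -X ω) = fun ω => Real.exp (-a * X ω) := by
      funext ω; simp
    rw [e] at h2
    exact ⟨h2.integrable_iff.2 ha, h2.integral_eq⟩
  set δ := min (ε / 100) lam with hδdef
  have hδ : 0 < δ := lt_min (by positivity) hlam
  have hδ1 : δ ≤ ε / 100 := min_le_left _ _
  have hδ2 : δ ≤ lam := min_le_right _ _
  obtain ⟨hvpos, w, hvw, hI⟩ := aux_rate μ X hsym m hm hXnondeg Ψ hΨdef lam ε δ hlam hδ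
    (by linarith) hexp hcrit I₁ hI₁
  set v := Ψ lam / lam with hv
  refine ⟨min (lam / 40) (ε / 200), lt_min (by positivity) (by positivity), ?_⟩
  -- eventual properties of r
  have hev : ∀ᶠ s : ℕ in Filter.atTop, 1 ≤ s ∧ 1 ≤ r s ∧ r s / s ≤ w := by
    have h1 : ∀ᶠ s : ℕ in Filter.atTop, (r s - v * (s : ℝ)) / (s : ℝ) < w - v :=
      hr.eventually_lt_const (by linarith)
    have h2 : ∀ᶠ s : ℕ in Filter.atTop, -(v / 2) < (r s - v * (s : ℝ)) / (s : ℝ) :=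
      hr.eventually_const_lt (by linarith)
    have h3 : ∀ᶠ s : ℕ in Filter.atTop, 2 / v ≤ (s : ℝ) :=
      tendsto_natCast_atTop_atTop.eventually_ge_atTop _
    filter_upwards [h1, h2, h3, Filter.eventually_ge_atTop 1] with s h1 h2 h3 h4
    have hs : (0:ℝ) < s := by exact_mod_cast h4
    have e : (r s - v * (s : ℝ)) / (s : ℝ) = r s / s - v := by field_simp
    rw [e] at h1 h2
    refine ⟨h4, ?_, by linarith⟩
    have h5 : v / 2 < r s / s := by linarith
    rw [lt_div_iff₀ hs] at h5
    rw [div_le_iff₀ hvpos] at h3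
    linarith
  obtain ⟨s₀, hs₀⟩ := Filter.eventually_atTop.1 hev
  refine ⟨s₀, fun s hs => ?_⟩
  obtain ⟨hs1, hr1, hrw⟩ := hs₀ s hs
  have hsp : (0:ℝ) < s := by exact_mod_cast hs1
  -- norm facts
  have hnc : ∀ p : ℝ × ℝ, nrm p = ‖(⟨p.1, p.2⟩ : ℂ)‖ := by
    intro p; rw [hnrm, Complex.norm_eq_sqrt_sq_add_sq]
  have hn0 : ∀ p, 0 ≤ nrm p := fun p => by rw [hnrm]; positivity
  have hadd : ∀ p q, nrm (p + q) ≤ nrm p + nrm q := by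
    intro p q
    rw [hnc, hnc p, hnc q]
    exact norm_add_le (⟨p.1, p.2⟩ : ℂ) ⟨q.1, q.2⟩
  have hsub : ∀ p q, nrm (p - q) ≤ nrm p + nrm q := by
    intro p q
    rw [hnc, hnc p, hnc q]
    exact norm_sub_le (⟨p.1, p.2⟩ : ℂ) ⟨q.1, q.2⟩
  have hsq : ∀ p, nrm p ^ 2 = p.1 ^ 2 + p.2 ^ 2 := by
    intro p; rw [hnrm, Real.sq_sqrt (by positivity)]
  have hH0 : h s 0 ((r s, 0), (0, 0), (0, 0)) = 2 * lam * r s - I₁ (r s / s) * s := by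
    have e1 : nrm (r s, 0) = r s := by
      rw [hnrm]; simp [Real.sqrt_sq (by linarith : (0:ℝ) ≤ r s)]
    have e2 : nrm (0, 0) = 0 := by rw [hnrm]; simp
    rw [hhdef]
    simp only [e1, e2]
    simp; ring
  -- key estimate
  have key : ∀ α ∈ Set.Icc (0:ℝ) (Real.pi / 2), ∀ p ∈ B (r s),
      (nrm (p.2.1 - p.2.2) / 2 ≤ max (nrm (p.1 + p.2.1)) (nrm (p.1 + p.2.2)) ∧
        max (nrm (p.1 + p.2.1)) (nrm (p.1 + p.2.2)) ≤ r s) ∧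
      (lam - δ) * (r s - max (nrm (p.1 + p.2.1)) (nrm (p.1 + p.2.2)))
          + 2 * lam * max (nrm (p.1 + p.2.1)) (nrm (p.1 + p.2.2)) *
            (1 - Real.cos (α - Real.arcsin ((nrm (p.2.1 - p.2.2) / 2) /
              max (nrm (p.1 + p.2.1)) (nrm (p.1 + p.2.2)))))
          + 0.99 * ε * (nrm (p.2.1 - p.2.2) / 2)
          ≤ h s 0 ((r s, 0), (0, 0), (0, 0)) - h s α p := by
    intro α hα p hp
    rw [hB] at hp
    obtain ⟨hp0, hp1, hp2⟩ := hp
    have hc : 0 ≤ Real.cos α := Real.cos_nonneg_of_mem_Icc ⟨by linarith [hα.1, Real.pi_pos], hα.2⟩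
    have hsn : 0 ≤ Real.sin α :=
      Real.sin_nonneg_of_nonneg_of_le_pi hα.1 (by linarith [hα.2, Real.pi_pos])
    have hM1 := le_max_left (nrm (p.1 + p.2.1)) (nrm (p.1 + p.2.2))
    have hM2 := le_max_right (nrm (p.1 + p.2.1)) (nrm (p.1 + p.2.2))
    have hMr : max (nrm (p.1 + p.2.1)) (nrm (p.1 + p.2.2)) ≤ r s := max_le hp1 hp2
    have hY1 := le_max_left (nrm p.2.1) (nrm p.2.2)
    have hY2 := le_max_right (nrm p.2.1) (nrm p.2.2)
    have hMY : max (nrm (p.1 + p.2.1)) (nrm (p.1 + p.2.2)) ≤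
        nrm p.1 + max (nrm p.2.1) (nrm p.2.2) :=
      max_le (by linarith [hadd p.1 p.2.1]) (by linarith [hadd p.1 p.2.2])
    have hDY : nrm (p.2.1 - p.2.2) / 2 ≤ max (nrm p.2.1) (nrm p.2.2) := by
      linarith [hsub p.2.1 p.2.2]
    have hS := hI (nrm p.1 / s) (r s / s) (div_nonneg (hn0 _) hsp.le) (by gcongr) hrw
    have hD0 : 0 ≤ nrm (p.2.1 - p.2.2) / 2 := by linarith [hn0 (p.2.1 - p.2.2)]
    have q1 := hsq (p.1 + p.2.1)
    have q2 := hsq (p.1 + p.2.2)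
    have q3 := hsq (p.2.1 - p.2.2)
    have q4 := pow_le_pow_left₀ (hn0 _) hM1 2
    have q5 := pow_le_pow_left₀ (hn0 _) hM2 2
    rw [hH0, hhdef]
    simp only [Prod.fst_add, Prod.snd_add, Prod.fst_sub, Prod.snd_sub] at q1 q2 q3
    have hM0 := (hn0 _).trans hM1
    set M := max (nrm (p.1 + p.2.1)) (nrm (p.1 + p.2.2))
    set D := nrm (p.2.1 - p.2.2) / 2 with hDd
    set Y := max (nrm p.2.1) (nrm p.2.2)
    obtain ⟨g1, g2⟩ := aux_geo (p.1.1 + p.2.1.1) (p.1.2 + p.2.1.2) (p.1.1 + p.2.2.1)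
      (p.1.2 + p.2.2.2) M D α hM0 hD0 hc hsn (by linarith) (by linarith)
      (by rw [hDd]; linear_combination -q3)
    refine ⟨⟨g1, hMr⟩, ?_⟩
    have hS' : I₁ (r s / s) * s - I₁ (nrm p.1 / s) * s ≤ (lam + δ) * (r s - nrm p.1) := by
      have := mul_le_mul_of_nonneg_right hS hsp.le
      have e : (lam + δ) * (r s / s - nrm p.1 / s) * s = (lam + δ) * (r s - nrm p.1) := by
        field_simp
      rw [e] at this
      linarith
    have g3 := mul_le_mul_of_nonneg_left g2 hlam.le
    have g4 := mul_le_mul_of_nonneg_left hMY (by linarith : 0 ≤ lam + δ)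
    have g5 : 0.99 * ε * D ≤ (ε - δ) * Y :=
      mul_le_mul (by linarith) hDY hD0 (by linarith)
    linarith
  have hmaxeq : hmax s = h s 0 ((r s, 0), (0, 0), (0, 0)) := by
    rw [hhmax]
    apply IsGreatest.csSup_eq
    constructor
    · refine ⟨0, ⟨le_rfl, by positivity⟩, _, ?_, rfl⟩
      have e1 : nrm (r s, 0) = r s := by
        rw [hnrm]; simp [Real.sqrt_sq (by linarith : (0:ℝ) ≤ r s)]
      rw [hB]
      simp [e1]
    · rintro _ ⟨α, hα, p, hp, rfl⟩
      obtain ⟨⟨k1, k2⟩, k3⟩ := key α hα p hp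
      have hD0 : 0 ≤ nrm (p.2.1 - p.2.2) / 2 := by linarith [hn0 (p.2.1 - p.2.2)]
      have hM0 := hD0.trans k1
      have t1 : 0 ≤ (lam - δ) * (r s - max (nrm (p.1 + p.2.1)) (nrm (p.1 + p.2.2))) :=
        mul_nonneg (by linarith) (by linarith)
      have t2 : 0 ≤ 0.99 * ε * (nrm (p.2.1 - p.2.2) / 2) := by positivity
      have t3 := mul_nonneg (mul_nonneg (by linarith : 0 ≤ 2 * lam) hM0)
        (sub_nonneg.2 (Real.cos_le_one (α - Real.arcsin ((nrm (p.2.1 - p.2.2) / 2) /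
              max (nrm (p.1 + p.2.1)) (nrm (p.1 + p.2.2))))))
      linarith
  refine ⟨hmaxeq, ?_, ?_⟩
  · intro α hα p hp _
    obtain ⟨⟨k1, k2⟩, k3⟩ := key α ⟨hα.1, by linarith [hα.2, Real.pi_pos]⟩ p hp
    rw [hmaxeq]
    have := mul_le_mul_of_nonneg_right (by linarith : lam - ε / 10 ≤ lam - δ) (sub_nonneg.2 k2)
    linarith
  · intro α hα p hp
    obtain ⟨⟨k1, k2⟩, k3⟩ := key α hα p hp
    have hD0 : 0 ≤ nrm (p.2.1 - p.2.2) / 2 := by linarith [hn0 (p.2.1 - p.2.2)]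
    have q := aux_quad lam ε (r s) _ _ α hlam hε hr1 hD0 k1 k2 hα.1 hα.2
    rw [hmaxeq]
    have := mul_le_mul_of_nonneg_right (by linarith : lam - ε / 10 + ε / 20 ≤ lam - δ)
      (sub_nonneg.2 k2)
    linarith
end

section
/- There exists ε₀ > 0 such that for every ε ∈ (0, ε₀] there exists t₀ ∈ ℕ such that for all integers t ≥ t₀, all y ∈ [1, t^{1/2}], and all integers 0 ≤ s ≤ t, the inequality (g^{t,y}_s)² + (h^t_s)² ≤ (f^{t,y}_s)² holds, where g^{t,y}_s = f^{t,y}_s − ε·(min(s, t−s))^{0.4}·1{ s > M^{5/3}/(ε^{5/3}λ^{5/3}) } − (M/λ)·1{ s ≤ M^{5/3}/(ε^{5/3}λ^{5/3}) } − (1/2)·1{ s = t }, and h^t_s = max( ε·min(s^{0.6}, t^{1/2}), M/λ ). -/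
open scoped Classical

lemma aux_sq (F δ h : ℝ) (h0 : 0 ≤ δ) (h1 : δ ≤ F) (h2 : h ^ 2 ≤ δ * F) :
    (F - δ) ^ 2 + h ^ 2 ≤ F ^ 2 := by
  nlinarith [mul_nonneg h0 (sub_nonneg.2 h1)]

lemma aux_log (Ψ : ℝ) (hΨ : 0 < Ψ) :
    ∃ S : ℝ, 1 ≤ S ∧ ∀ s : ℝ, S ≤ s → 3 / 2 * Real.log (s + 1) ≤ Ψ / 2 * s := by
  have h := (Real.isLittleO_log_id_atTop.bound (show (0:ℝ) < Ψ / 6 by positivity))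
  obtain ⟨A, hA⟩ := Filter.eventually_atTop.1 h
  refine ⟨max 1 A, le_max_left _ _, fun s hs => ?_⟩
  have h1 : 1 ≤ s := (le_max_left _ _).trans hs
  have h2 : A ≤ s := (le_max_right _ _).trans hs
  have h3 := hA (s + 1) (by linarith)
  simp only [id, Real.norm_eq_abs] at h3
  rw [abs_of_nonneg (show (0:ℝ) ≤ s + 1 by linarith)] at h3
  have h4 := (le_abs_self _).trans h3
  nlinarith

lemma aux_ratio (s t : ℝ) (h0 : 0 ≤ s) (h1 : s ≤ t) :
    Real.log ((t + 1) / (t - s + 1)) ≤ Real.log (s + 1) := by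
  apply Real.log_le_log
  · apply div_pos <;> linarith
  · rw [div_le_iff₀ (by linarith)]
    nlinarith [mul_nonneg h0 (sub_nonneg.2 h1)]

set_option maxHeartbeats 1000000 in
/-- Lemma "colic" of the paper: for sufficiently small `ε > 0` and large `t`,
`(g^{t,y}_s)² + (h^t_s)² ≤ (f^{t,y}_s)²` for all `0 ≤ s ≤ t` and `y ∈ [1, √t]`. -/
theorem stmt_19 (d : ℕ) (hd : 2 ≤ d) (lam Ψ M : ℝ)
    (hlam : 0 < lam) (hΨ : 0 < Ψ) (hM : max 1 lam < M)
    (hpos : ∀ t s : ℕ, s ≤ t →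
      0 ≤ Ψ * (s : ℝ) + ((d : ℝ) - 1) / 2 * Real.log ((s : ℝ) + 1)
        - 3 / 2 * Real.log (((t : ℝ) + 1) / ((t : ℝ) - (s : ℝ) + 1)) + M)
    (f : ℕ → ℝ → ℕ → ℝ)
    (hf : ∀ (t : ℕ) (y : ℝ) (s : ℕ), f t y s =
      Ψ / lam * (s : ℝ) + ((d : ℝ) - 1) / (2 * lam) * Real.log ((s : ℝ) + 1)
        - 3 / (2 * lam) * Real.log (((t : ℝ) + 1) / ((t : ℝ) - (s : ℝ) + 1))
        + 3 * M / lam + y / lam) :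
    ∃ ε₀ : ℝ, 0 < ε₀ ∧ ∀ ε : ℝ, 0 < ε → ε ≤ ε₀ →
      ∃ t₀ : ℕ, ∀ t : ℕ, t₀ ≤ t → ∀ y : ℝ, 1 ≤ y → y ≤ Real.sqrt (t : ℝ) →
        ∀ s : ℕ, s ≤ t →
          (f t y s
            - (if M ^ ((5:ℝ)/3) / (ε ^ ((5:ℝ)/3) * lam ^ ((5:ℝ)/3)) < (s : ℝ)
                then ε * ((min s (t - s) : ℕ) : ℝ) ^ ((0.4 : ℝ))
                else M / lam)
            - (if s = t then 1 / 2 else 0)) ^ 2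
          + (max (ε * min ((s : ℝ) ^ ((0.6 : ℝ))) (Real.sqrt (t : ℝ))) (M / lam)) ^ 2
          ≤ (f t y s) ^ 2 := by
  have hM1 : 1 < M := (le_max_left _ _).trans_lt hM
  have hM0 : 0 < M := by linarith
  obtain ⟨S, hS1, hS⟩ := aux_log Ψ hΨ
  set c : ℝ := Ψ / (2 * lam) with hc
  have hc0 : 0 < c := by positivity
  have hd1 : (0:ℝ) ≤ (d:ℝ) - 1 := by
    have : (2:ℝ) ≤ d := by exact_mod_cast hd
    linarith
  -- lower bounds for f
  have hfM : ∀ (t : ℕ) (y : ℝ) (s : ℕ), 1 ≤ y → s ≤ t → 2 * (M / lam) ≤ f t y s := by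
    intro t y s hy hst
    have h := div_nonneg (hpos t s hst) hlam.le
    have h2 : f t y s = (Ψ * (s : ℝ) + ((d : ℝ) - 1) / 2 * Real.log ((s : ℝ) + 1)
        - 3 / 2 * Real.log (((t : ℝ) + 1) / ((t : ℝ) - (s : ℝ) + 1)) + M) / lam
        + 2 * (M / lam) + y / lam := by
      rw [hf]; field_simp; ring
    have : 0 ≤ y / lam := by positivity
    linarith
  have hfc : ∀ (t : ℕ) (y : ℝ) (s : ℕ), 1 ≤ y → s ≤ t → S ≤ (s:ℝ) → c * s ≤ f t y s := by
    intro t y s hy hst hSs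
    have hr := aux_ratio (s:ℝ) t (Nat.cast_nonneg s) (by exact_mod_cast hst)
    have hs := hS s hSs
    have hl : 0 ≤ Real.log ((s:ℝ) + 1) := Real.log_nonneg (by linarith)
    have h2 : f t y s - c * s = (Ψ / 2 * (s : ℝ) + ((d : ℝ) - 1) / 2 * Real.log ((s : ℝ) + 1)
        - 3 / 2 * Real.log (((t : ℝ) + 1) / ((t : ℝ) - (s : ℝ) + 1)) + 3 * M + y) / lam := by
      rw [hf, hc]; field_simp; ring
    have h3 : 0 ≤ ((d : ℝ) - 1) / 2 * Real.log ((s : ℝ) + 1) := by positivity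
    have : 0 ≤ f t y s - c * s := by
      rw [h2]; apply div_nonneg _ hlam.le; linarith
    linarith
  have hS0 : 0 < S := by linarith
  refine ⟨min 1 (min (c / 2) (M / (lam * S))), by positivity, fun ε hε hεε => ?_⟩
  have hε1 : ε ≤ 1 := hεε.trans (min_le_left _ _)
  have hε2 : ε ≤ c / 2 := hεε.trans ((min_le_right _ _).trans (min_le_left _ _))
  have hε3 : ε ≤ M / (lam * S) := hεε.trans ((min_le_right _ _).trans (min_le_right _ _))
  set x : ℝ := M / (ε * lam) with hx
  have hxS : S ≤ x := by
    rw [hx, le_div_iff₀ (by positivity)]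
    rw [le_div_iff₀ (by positivity)] at hε3
    linarith
  have hx1 : 1 ≤ x := hS1.trans hxS
  have hx0 : 0 ≤ x := by linarith
  have hT : M ^ ((5:ℝ)/3) / (ε ^ ((5:ℝ)/3) * lam ^ ((5:ℝ)/3)) = x ^ ((5:ℝ)/3) := by
    rw [hx, Real.div_rpow hM0.le (by positivity), Real.mul_rpow hε.le hlam.le]
  rw [hT]
  have hTx : x ≤ x ^ ((5:ℝ)/3) := by
    have := Real.rpow_le_rpow_of_exponent_le hx1 (show (1:ℝ) ≤ 5/3 by norm_num)
    rwa [Real.rpow_one] at this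
  have hT2 : x ^ ((5:ℝ)/3) ≤ x ^ 2 := by
    have := Real.rpow_le_rpow_of_exponent_le hx1 (show (5/3:ℝ) ≤ (2:ℕ) by norm_num)
    rwa [Real.rpow_natCast] at this
  have hεx : ε * x = M / lam := by rw [hx]; field_simp
  have hT6 : (x ^ ((5:ℝ)/3)) ^ (0.6:ℝ) = x := by
    rw [← Real.rpow_mul hx0]; norm_num
  refine ⟨⌈x ^ 2 + 1 + 1 / c⌉₊, fun t ht y hy _ s hst => ?_⟩
  have ht1 : x ^ 2 + 1 + 1 / c ≤ t := Nat.ceil_le.1 ht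
  have hc1 : 0 < 1 / c := by positivity
  have htc : 1 ≤ c * t := by
    have : 1 / c ≤ t := by nlinarith
    rw [div_le_iff₀ hc0] at this
    linarith
  have hs0 : (0:ℝ) ≤ s := Nat.cast_nonneg s
  have hst' : (s:ℝ) ≤ t := by exact_mod_cast hst
  have hF := hfM t y s hy hst
  have hML : 0 < M / lam := by positivity
  rw [sub_sub]
  by_cases hsT : x ^ ((5:ℝ)/3) < (s:ℝ)
  · rw [if_pos hsT]
    have hFc := hfc t y s hy hst (by linarith)
    set F := f t y s
    have hs1 : (1:ℝ) ≤ s := by linarith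
    have hxs : x ≤ (s:ℝ) ^ (0.6:ℝ) := by
      rw [← hT6]; exact Real.rpow_le_rpow (by positivity) hsT.le (by norm_num)
    have hxt : x ≤ Real.sqrt t := Real.le_sqrt_of_sq_le (by linarith)
    have hmax : max (ε * min ((s : ℝ) ^ ((0.6 : ℝ))) (Real.sqrt (t : ℝ))) (M / lam)
        = ε * min ((s : ℝ) ^ ((0.6 : ℝ))) (Real.sqrt (t : ℝ)) := by
      apply max_eq_left
      rw [← hεx]
      exact mul_le_mul_of_nonneg_left (le_min hxs hxt) hε.le
    rw [hmax]
    have hm0 : 0 ≤ min ((s : ℝ) ^ ((0.6 : ℝ))) (Real.sqrt (t : ℝ)) := by positivity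
    have hmt : (min ((s : ℝ) ^ ((0.6 : ℝ))) (Real.sqrt (t : ℝ))) ^ 2 ≤ t := by
      calc _ ≤ (Real.sqrt t) ^ 2 := pow_le_pow_left₀ hm0 (min_le_right _ _) 2
        _ = t := Real.sq_sqrt (Nat.cast_nonneg t)
    have hms : (min ((s : ℝ) ^ ((0.6 : ℝ))) (Real.sqrt (t : ℝ))) ^ 2
        ≤ (s:ℝ) ^ (0.4:ℝ) * s := by
      calc _ ≤ ((s:ℝ) ^ (0.6:ℝ)) ^ 2 := pow_le_pow_left₀ hm0 (min_le_left _ _) 2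
        _ = (s:ℝ) ^ (1.2:ℝ) := by
          rw [← Real.rpow_mul_natCast hs0]; norm_num
        _ ≤ (s:ℝ) ^ (1.4:ℝ) := Real.rpow_le_rpow_of_exponent_le hs1 (by norm_num)
        _ = (s:ℝ) ^ (0.4:ℝ) * s := by
          rw [← Real.rpow_add_one (by linarith)]; norm_num
    set m := min ((s : ℝ) ^ ((0.6 : ℝ))) (Real.sqrt (t : ℝ))
    have hm2 : 0 ≤ m ^ 2 := sq_nonneg m
    have hs4 : (s:ℝ) ^ (0.4:ℝ) ≤ s := by
      have := Real.rpow_le_rpow_of_exponent_le hs1 (show (0.4:ℝ) ≤ 1 by norm_num)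
      rwa [Real.rpow_one] at this
    by_cases hEq : s = t
    · rw [if_pos hEq, hEq]
      have hEq' : (s:ℝ) = t := by exact_mod_cast hEq
      rw [hEq'] at hFc
      have h0 : ((min t (t - t) : ℕ) : ℝ) ^ (0.4:ℝ) = 0 := by
        simp
        norm_num
      rw [h0, mul_zero, zero_add]
      apply aux_sq _ _ _ (by norm_num) (by linarith)
      have : (ε * m) ^ 2 ≤ (c / 2) * t := by
        calc (ε * m) ^ 2 = (ε * ε) * m ^ 2 := by ring
          _ ≤ (c / 2) * t := by
            apply mul_le_mul _ hmt hm2 (by positivity)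
            nlinarith
      linarith
    · rw [if_neg hEq, add_zero]
      have hlt : s < t := lt_of_le_of_ne hst hEq
      have hn1 : (1:ℝ) ≤ ((min s (t - s) : ℕ) : ℝ) := by
        have h1 : 1 ≤ s := by exact_mod_cast hs1
        have : 1 ≤ min s (t - s) := by omega
        exact_mod_cast this
      have hns : ((min s (t - s) : ℕ) : ℝ) ≤ s := by exact_mod_cast min_le_left _ _
      have hδs : ((min s (t - s) : ℕ) : ℝ) ^ (0.4:ℝ) ≤ (s:ℝ) ^ (0.4:ℝ) :=
        Real.rpow_le_rpow (by linarith) hns (by norm_num)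
      have hδ1 : 1 ≤ ((min s (t - s) : ℕ) : ℝ) ^ (0.4:ℝ) :=
        Real.one_le_rpow hn1 (by norm_num)
      apply aux_sq _ _ _ (by positivity)
      · have : ε * ((min s (t - s) : ℕ) : ℝ) ^ (0.4:ℝ) ≤ c * s :=
          mul_le_mul (by linarith) (hδs.trans hs4) (by linarith) hc0.le
        linarith
      · have key : m ^ 2 ≤ 2 * (((min s (t - s) : ℕ) : ℝ) ^ (0.4:ℝ) * s) := by
          rcases le_total s (t - s) with h | h
          · rw [min_eq_left h]
            have : 0 ≤ (s:ℝ) ^ (0.4:ℝ) * s := by positivity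
            linarith
          · have h2 : (t:ℝ) ≤ 2 * s := by
              have : t ≤ 2 * s := by omega
              exact_mod_cast this
            have h3 := mul_le_mul_of_nonneg_right hδ1 hs0
            linarith
        set D := ((min s (t - s) : ℕ) : ℝ) ^ (0.4:ℝ)
        have hD : 0 ≤ D := by linarith
        calc (ε * m) ^ 2 = ε * (ε * m ^ 2) := by ring
          _ ≤ ε * ((c / 2) * (2 * (D * s))) := by gcongr
          _ = ε * D * (c * s) := by ring
          _ ≤ ε * D * F := by gcongr
  · rw [if_neg hsT]
    push Not at hsT
    have hne : s ≠ t := by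
      intro h
      have : (s:ℝ) = t := by exact_mod_cast h
      linarith
    rw [if_neg hne, add_zero]
    have hsx : (s:ℝ) ^ (0.6:ℝ) ≤ x := by
      rw [← hT6]; exact Real.rpow_le_rpow hs0 hsT (by norm_num)
    rw [max_eq_right]
    · apply aux_sq _ _ _ hML.le (by linarith)
      nlinarith
    · rw [← hεx]
      exact mul_le_mul_of_nonneg_left ((min_le_left _ _).trans hsx) hε.le
end
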